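/- arXiv:1703.03242 — 3 statements merged into one kernel-verified Lean document; each statement's English description precedes it below -/
import Mathlib

section
/- Let m be a positive integer and let W = (mℕ + X_m) ∪ Y⁰ ∪ Y¹, where X_m ⊆ {0,1,...,m-1}, Y⁰ is a finite set of negative integers with Y⁰ mod m ⊆ X_m, and Y¹ is a (possibly infinite) set of integers with (Y¹ mod m) ∩ X_m = ∅ and such that Y¹ contains only finitely many negative integers. If there exists a minimal additive complement to W in ℤ, then there exists a set C ⊆ {0,1,...,m-1} such that: (a) C + (X_m ∪ Y¹) mod m = {0,1,...,m-1}; and (b) for every c ∈ C there exists y ∈ Y¹ such that c + y ≢ c' + x (mod m) for every c' ∈ C and every x ∈ X_m. -/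
open Pointwise

/-- `mNX m X = {k*m + x : k ∈ ℕ, x ∈ X}`, i.e. `mℕ + X`. -/
def mNX (m : ℤ) (X : Set ℤ) : Set ℤ := {n : ℤ | ∃ k : ℕ, ∃ x ∈ X, n = (k : ℤ) * m + x}

/-- `modSet S m` is the set of residues of `S` modulo `m`. -/
def modSet (S : Set ℤ) (m : ℤ) : Set ℤ := (fun s => s % m) '' S

/-- `A` is an additive complement to `B` in `ℤ`. -/
def IsComplement (A B : Set ℤ) : Prop := A + B = Set.univ

/-- `A` is a minimal additive complement to `B` in `ℤ`. -/
def IsMinComplement (A B : Set ℤ) : Prop :=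
  IsComplement A B ∧ ∀ A' ⊂ A, ¬ IsComplement A' B

/-- The residues modulo `m` whose class meets `A` in a set unbounded below. -/
def cofinalResidues (A : Set ℤ) (m : ℤ) : Set ℤ :=
  {c ∈ Set.Ico (0 : ℤ) m | ∀ N : ℤ, ∃ a ∈ A, a < N ∧ a % m = c}

/-- All sufficiently negative elements of `A` have their residue in `cofinalResidues A m`. -/
theorem exists_forall_lt_emod_mem_cofinalResidues (A : Set ℤ) {m : ℤ} (hm : 0 < m) :
    ∃ N : ℤ, ∀ a ∈ A, a < N → a % m ∈ cofinalResidues A m := by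
  have key : ∀ c : ℤ, ∃ N : ℤ, c ∈ Set.Ico 0 m → c ∉ cofinalResidues A m →
      ∀ a ∈ A, a % m = c → N ≤ a := by
    intro c
    by_cases hc : ∀ N : ℤ, ∃ a ∈ A, a < N ∧ a % m = c
    · exact ⟨0, fun h h' => absurd ⟨h, hc⟩ h'⟩
    · push Not at hc
      obtain ⟨N, hN⟩ := hc
      exact ⟨N, fun _ _ a ha hac => not_lt.mp fun h => hN a ha h hac⟩
  choose f hf using key
  obtain ⟨N, hN⟩ := ((Set.finite_Ico (0 : ℤ) m).image f).bddBelow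
  refine ⟨N, fun a ha haN => ?_⟩
  by_contra hc
  have hmem : a % m ∈ Set.Ico (0 : ℤ) m :=
    ⟨Int.emod_nonneg _ hm.ne', Int.emod_lt_of_pos _ hm⟩
  have h1 := hf _ hmem hc a ha rfl
  have h2 := hN (Set.mem_image_of_mem f hmem)
  omega

theorem mem_mNX_of_modEq {m n x : ℤ} {X : Set ℤ} (hm : 0 < m) (hX : X ⊆ Set.Ico 0 m)
    (hx : x ∈ X) (hn : 0 ≤ n) (h : n ≡ x [ZMOD m]) : n ∈ mNX m X := by
  have hmod : n % m = x := Eq.trans h (Int.emod_eq_of_lt (hX hx).1 (hX hx).2)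
  refine ⟨(n / m).toNat, x, hx, ?_⟩
  rw [Int.toNat_of_nonneg (Int.ediv_nonneg hn hm.le), ← hmod]
  exact (Int.ediv_mul_add_emod n m).symm

/-- An integer congruent to `c + x`, with `c` a cofinal residue and `x ∈ X`, has representations
in `A + mNX m X` with an arbitrarily negative first summand. -/
theorem exists_lt_sub_mem_mNX {m n c x : ℤ} {A X : Set ℤ} (hm : 0 < m) (hX : X ⊆ Set.Ico 0 m)
    (hc : c ∈ cofinalResidues A m) (hx : x ∈ X) (h : n ≡ c + x [ZMOD m]) (N : ℤ) :
    ∃ a ∈ A, a < N ∧ n - a ∈ mNX m X := by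
  obtain ⟨a, ha, hlt, hac⟩ := hc.2 (min N n)
  refine ⟨a, ha, hlt.trans_le (min_le_left _ _), mem_mNX_of_modEq hm hX hx ?_ ?_⟩
  · have := min_le_right N n
    omega
  · have h1 : a ≡ c [ZMOD m] := by rw [← hac]; exact (Int.mod_modEq a m).symm
    simpa using h.sub h1

/-- Every element of a minimal complement is needed to represent some integer. -/
theorem IsMinComplement.exists_unique_left {A B : Set ℤ} (h : IsMinComplement A B) {a : ℤ}
    (ha : a ∈ A) : ∃ b ∈ B, ∀ a' ∈ A, a + b - a' ∈ B → a' = a := by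
  have h1 := h.2 (A \ {a}) ⟨Set.sdiff_subset, fun hs => (hs ha).2 rfl⟩
  obtain ⟨n, hn⟩ := (Set.ne_univ_iff_exists_notMem _).mp h1
  have hnA : n ∈ A + B := h.1 ▸ Set.mem_univ n
  have hn' : ∀ a' ∈ A, n - a' ∈ B → a' = a := by
    intro a' ha' hb'
    by_contra hne
    exact hn ⟨a', ⟨ha', hne⟩, n - a', hb', by simp⟩
  obtain ⟨a₀, ha₀, b, hb, rfl⟩ := hnA
  obtain rfl : a₀ = a := hn' a₀ ha₀ (by simpa using hb)
  exact ⟨b, hb, hn'⟩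

theorem stmt_1 (m : ℤ) (hm : 0 < m) (Xm Y0 Y1 : Set ℤ)
    (hXm : Xm ⊆ Set.Ico 0 m)
    (hY0fin : Y0.Finite) (hY0neg : ∀ y ∈ Y0, y < 0)
    (hY0mod : modSet Y0 m ⊆ Xm)
    (hY1negfin : {y ∈ Y1 | y < 0}.Finite) (hY1mod : modSet Y1 m ∩ Xm = ∅)
    (hmin : ∃ A : Set ℤ, IsMinComplement A (mNX m Xm ∪ Y0 ∪ Y1)) :
    ∃ C ⊆ Set.Ico (0 : ℤ) m,
      modSet (C + (Xm ∪ Y1)) m = Set.Ico (0 : ℤ) m ∧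
      ∀ c ∈ C, ∃ y ∈ Y1, ∀ c' ∈ C, ∀ x ∈ Xm, ¬ (c + y ≡ c' + x [ZMOD m]) := by
  obtain ⟨A, hA⟩ := hmin
  refine ⟨cofinalResidues A m, fun c hc => hc.1, ?_, ?_⟩
  · apply Set.Subset.antisymm
    · rintro _ ⟨s, -, rfl⟩
      exact ⟨Int.emod_nonneg _ hm.ne', Int.emod_lt_of_pos _ hm⟩
    · intro r hr
      obtain ⟨N, hN⟩ := exists_forall_lt_emod_mem_cofinalResidues A hm
      obtain ⟨L₀, hL₀⟩ := hY0fin.bddBelow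
      obtain ⟨L₁, hL₁⟩ := hY1negfin.bddBelow
      have hL : ∀ w ∈ mNX m Xm ∪ Y0 ∪ Y1, -(|L₀| + |L₁|) ≤ w := by
        have := neg_abs_le L₀
        have := neg_abs_le L₁
        have := abs_nonneg L₀
        have := abs_nonneg L₁
        rintro w ((⟨k, x, hx, rfl⟩ | hw) | hw)
        · have := (hXm hx).1
          have := mul_nonneg (Int.natCast_nonneg k) hm.le
          omega
        · have := hL₀ hw
          omega
        · by_cases hneg : w < 0
          · have := hL₁ ⟨hw, hneg⟩
            omega
          · omega
      set t : ℤ := |r| + |N| + (|L₀| + |L₁|) + 1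
      obtain ⟨a, ha, w, hw, haw⟩ : r - m * t ∈ A + (mNX m Xm ∪ Y0 ∪ Y1) :=
        hA.1 ▸ Set.mem_univ _
      have haw' : a + w = r - m * t := haw
      have haN : a < N := by
        have h1 : t ≤ m * t := le_mul_of_one_le_left (by positivity) hm
        have := hL w hw
        have := le_abs_self r
        have := neg_abs_le N
        omega
      have hr' : (a + w) % m = r := by
        rw [haw', Int.sub_mul_emod_self_left, Int.emod_eq_of_lt hr.1 hr.2]
      obtain ⟨v, hv, hvw⟩ : ∃ v ∈ Xm ∪ Y1, v ≡ w [ZMOD m] := by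
        rcases hw with (⟨k, x, hx, rfl⟩ | hw) | hw
        · exact ⟨x, Or.inl hx, by simp [Int.ModEq]⟩
        · exact ⟨w % m, Or.inl (hY0mod ⟨w, hw, rfl⟩), Int.mod_modEq w m⟩
        · exact ⟨w, Or.inr hw, rfl⟩
      refine ⟨a % m + v, ⟨a % m, hN a ha haN, v, hv, rfl⟩, ?_⟩
      exact Eq.trans ((Int.mod_modEq a m).add hvw) hr'
  · intro c hc
    obtain ⟨a, ha, -, hac⟩ := hc.2 0
    have hac' : c ≡ a [ZMOD m] := by rw [← hac]; exact Int.mod_modEq a m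
    obtain ⟨w, hw, huniq⟩ := hA.exists_unique_left ha
    have hno : ∀ c' ∈ cofinalResidues A m, ∀ x ∈ Xm, ¬ (c + w ≡ c' + x [ZMOD m]) := by
      intro c' hc' x hx h
      obtain ⟨a', ha', hlt, hmem⟩ :=
        exists_lt_sub_mem_mNX hm hXm hc' hx ((hac'.symm.add_right w).trans h) a
      exact hlt.ne (huniq a' ha' (Or.inl (Or.inl hmem)))
    rcases hw with (⟨k, x, hx, rfl⟩ | hw) | hw
    · exact absurd (by simp [Int.ModEq, Int.add_emod]) (hno c hc x hx)
    · exact absurd ((Int.mod_modEq w m).symm.add_left c)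
        (hno c hc (w % m) (hY0mod ⟨w, hw, rfl⟩))
    · exact ⟨w, hw, hno⟩
end

section
/- Let m be a positive integer and let W = (mℕ + X_m) ∪ Y⁰ ∪ {a}, where X_m ⊆ {0,1,...,m-1}, Y⁰ is a finite set of negative integers with Y⁰ mod m ⊆ X_m, and a is an integer with a ≢ x (mod m) for every x ∈ X_m. Then there exists a minimal additive complement to W in ℤ if and only if there exists a set C ⊆ {0,1,...,m-1} such that: (a) C + (X_m ∪ {a}) mod m = {0,1,...,m-1}; and (b) for every c ∈ C, c + a ≢ c' + x (mod m) for every c' ∈ C \ {c} and every x ∈ X_m. -/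
open Pointwise

/-- The residues `c` modulo `m` whose class meets `A` in a set unbounded below. -/
def lowResidues (A : Set ℤ) (m : ℤ) : Set ℤ :=
  {c | c ∈ Set.Ico 0 m ∧ ∀ N : ℤ, ∃ α ∈ A, α % m = c ∧ α ≤ N}

lemma isComplement_iff {A B : Set ℤ} : IsComplement A B ↔ ∀ n, ∃ α ∈ A, n - α ∈ B := by
  unfold IsComplement
  rw [Set.eq_univ_iff_forall]
  refine forall_congr' fun n => ?_
  rw [Set.mem_add]
  constructor
  · rintro ⟨α, hα, b, hb, rfl⟩
    exact ⟨α, hα, by simpa using hb⟩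
  · rintro ⟨α, hα, h⟩
    exact ⟨α, hα, n - α, h, by ring⟩

lemma mem_mNX_of_dvd {m n x : ℤ} {X : Set ℤ} (hm : 0 < m) (hx : x ∈ X) (hle : x ≤ n)
    (hdvd : m ∣ n - x) : n ∈ mNX m X := by
  obtain ⟨k, hk⟩ := hdvd
  have hk0 : 0 ≤ k := by
    by_contra! h
    nlinarith
  exact ⟨k.toNat, x, hx, by rw [Int.toNat_of_nonneg hk0]; linarith⟩

lemma exists_modEq_of_mem {m w : ℤ} {X Y : Set ℤ} (hY : modSet Y m ⊆ X)
    (hw : w ∈ mNX m X ∪ Y) : ∃ x ∈ X, w ≡ x [ZMOD m] := by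
  rcases hw with ⟨k, x, hx, rfl⟩ | hw
  · exact ⟨x, hx, by simp [Int.ModEq]⟩
  · exact ⟨w % m, hY ⟨w, hw, rfl⟩, (Int.mod_modEq w m).symm⟩

lemma exists_forall_lt_mem_lowResidues (A : Set ℤ) {m : ℤ} (hm : 0 < m) :
    ∃ B : ℤ, ∀ α ∈ A, α < B → α % m ∈ lowResidues A m := by
  have h : ∀ c : ℤ, ∃ B : ℤ, c ∈ Set.Ico 0 m → c ∉ lowResidues A m →
      ∀ α ∈ A, α % m = c → B < α := by
    intro c
    by_cases hc : c ∈ Set.Ico 0 m ∧ c ∉ lowResidues A m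
    · have h2 := hc.2
      simp only [lowResidues, Set.mem_ofPred_eq, not_and] at h2
      have h3 := h2 hc.1
      push Not at h3
      obtain ⟨N, hN⟩ := h3
      exact ⟨N, fun _ _ => hN⟩
    · exact ⟨0, fun h1 h2 => absurd ⟨h1, h2⟩ hc⟩
  choose f hf using h
  obtain ⟨B, hB⟩ := ((Set.finite_Ico (0 : ℤ) m).image f).bddBelow
  refine ⟨B, fun α hα hlt => ?_⟩
  by_contra hn
  have hr : α % m ∈ Set.Ico 0 m := ⟨Int.emod_nonneg _ hm.ne', Int.emod_lt_of_pos _ hm⟩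
  have h1 := hf _ hr hn α hα rfl
  have h2 := hB ⟨_, hr, rfl⟩
  omega

lemma exists_add_mem_mNX {A X : Set ℤ} {m c x n : ℤ} (hm : 0 < m)
    (hc : c ∈ lowResidues A m) (hx : x ∈ X) (hn : n ≡ c + x [ZMOD m]) (N : ℤ) :
    ∃ β ∈ A, β % m = c ∧ β ≤ N ∧ n - β ∈ mNX m X := by
  obtain ⟨β, hβ, hβc, hle⟩ := hc.2 (min N (n - x))
  refine ⟨β, hβ, hβc, hle.trans (min_le_left _ _), mem_mNX_of_dvd hm hx ?_ ?_⟩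
  · have := hle.trans (min_le_right _ _)
    linarith
  · have h1 : β ≡ c [ZMOD m] := hβc ▸ (Int.mod_modEq β m).symm
    have h2 := (h1.add_right x).trans hn.symm
    have h3 := h2.dvd
    rwa [show n - β - x = n - (β + x) by ring]

lemma modSet_eq_Ico_iff {S : Set ℤ} {m : ℤ} (hm : 0 < m) :
    modSet S m = Set.Ico 0 m ↔ ∀ n, ∃ s ∈ S, n ≡ s [ZMOD m] := by
  have hr (n : ℤ) : n % m ∈ Set.Ico 0 m :=
    ⟨Int.emod_nonneg _ hm.ne', Int.emod_lt_of_pos _ hm⟩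
  constructor
  · intro h n
    obtain ⟨s, hs, hsn⟩ := h.symm ▸ hr n
    exact ⟨s, hs, hsn.symm⟩
  · refine fun h => Set.Subset.antisymm ?_ fun n hn => ?_
    · rintro _ ⟨s, -, rfl⟩
      exact hr s
    · obtain ⟨s, hs, hns⟩ := h n
      exact ⟨s, hs, Eq.trans hns.symm (Int.emod_eq_of_lt hn.1 hn.2)⟩

theorem stmt_5 (m : ℤ) (hm : 0 < m) (Xm Y0 : Set ℤ) (a : ℤ)
    (hXm : Xm ⊆ Set.Ico 0 m)
    (hY0fin : Y0.Finite) (hY0neg : ∀ y ∈ Y0, y < 0)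
    (hY0mod : modSet Y0 m ⊆ Xm)
    (ha : ∀ x ∈ Xm, ¬ (a ≡ x [ZMOD m])) :
    (∃ A : Set ℤ, IsMinComplement A (mNX m Xm ∪ Y0 ∪ {a})) ↔
    ∃ C ⊆ Set.Ico (0 : ℤ) m,
      modSet (C + (Xm ∪ {a})) m = Set.Ico (0 : ℤ) m ∧
      ∀ c ∈ C, ∀ c' ∈ C \ {c}, ∀ x ∈ Xm, ¬ (c + a ≡ c' + x [ZMOD m]) := by
  constructor
  · rintro ⟨A, hA, hmin⟩
    rw [isComplement_iff] at hA
    refine ⟨lowResidues A m, fun c hc => hc.1, ?_, ?_⟩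
    · rw [modSet_eq_Ico_iff hm]
      intro r
      obtain ⟨B, hB⟩ := exists_forall_lt_mem_lowResidues A hm
      have hW : BddBelow (mNX m Xm ∪ Y0 ∪ {a}) := by
        refine (BddBelow.union ⟨0, ?_⟩ hY0fin.bddBelow).union (bddBelow_singleton (a := a))
        rintro _ ⟨k, x, hx, rfl⟩
        have := (hXm hx).1
        positivity
      obtain ⟨L, hL⟩ := hW
      obtain ⟨n, hnr, hn⟩ : ∃ n, n ≡ r [ZMOD m] ∧ n < B + L := by
        refine ⟨r - m * (|r| + |B + L| + 1), by simp [Int.modEq_iff_dvd], ?_⟩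
        have h1 := le_abs_self r
        have h2 := neg_abs_le (B + L)
        nlinarith [abs_nonneg r, abs_nonneg (B + L)]
      obtain ⟨α, hα, hw⟩ := hA n
      have hlow := hB α hα (by have := hL hw; linarith)
      have hmod : α % m ≡ α [ZMOD m] := Int.mod_modEq α m
      rcases hw with hw | hw
      · obtain ⟨x, hx, hwx⟩ := exists_modEq_of_mem hY0mod hw
        refine ⟨α % m + x, Set.add_mem_add hlow (Or.inl hx), ?_⟩
        have := hmod.symm.add hwx
        rw [add_sub_cancel] at this
        exact hnr.symm.trans this
      · refine ⟨α % m + a, Set.add_mem_add hlow (Or.inr rfl), ?_⟩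
        have := hmod.symm.add_right a
        rw [← Set.mem_singleton_iff.mp hw, add_sub_cancel] at this
        rw [← Set.mem_singleton_iff.mp hw]
        exact hnr.symm.trans this
    · intro c hc c' hc' x hx hcong
      obtain ⟨α, hα, hαc, -⟩ := hc.2 0
      refine hmin (A \ {α}) (Set.sdiff_singleton_ssubset.mpr hα) ?_
      rw [isComplement_iff]
      intro n
      obtain ⟨γ, hγ, hw⟩ := hA n
      by_cases hγα : γ = α
      swap
      · exact ⟨γ, ⟨hγ, hγα⟩, hw⟩
      subst hγα
      have hmod : γ ≡ c [ZMOD m] := hαc ▸ (Int.mod_modEq γ m).symm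
      rcases hw with hw | hw
      · obtain ⟨z, hz, hwz⟩ := exists_modEq_of_mem hY0mod hw
        have hn := hmod.add hwz
        rw [add_sub_cancel] at hn
        obtain ⟨β, hβ, -, hle, h⟩ := exists_add_mem_mNX hm hc hz hn (γ - 1)
        refine ⟨β, ⟨hβ, ?_⟩, Or.inl (Or.inl h)⟩
        rintro rfl
        omega
      · have hn := (hmod.add_right a).trans hcong
        rw [← Set.mem_singleton_iff.mp hw, add_sub_cancel] at hn
        obtain ⟨β, hβ, hβc, -, h⟩ := exists_add_mem_mNX hm hc'.1 hx hn 0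
        refine ⟨β, ⟨hβ, ?_⟩, Or.inl (Or.inl h)⟩
        rintro rfl
        exact hc'.2 (hβc.symm.trans hαc)
  · rintro ⟨C, -, hcov, hsep⟩
    rw [modSet_eq_Ico_iff hm] at hcov
    refine ⟨{n | ∃ c ∈ C, n ≡ c [ZMOD m]}, ?_, ?_⟩
    · rw [isComplement_iff]
      intro n
      obtain ⟨_, ⟨c, hc, w, hw, rfl⟩, hn⟩ := hcov n
      have hnc : n - w ≡ c [ZMOD m] := by simpa using hn.sub_right w
      refine ⟨n - w, ⟨c, hc, hnc⟩, ?_⟩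
      rw [sub_sub_cancel]
      rcases hw with hw | hw
      · exact Or.inl (Or.inl (mem_mNX_of_dvd hm hw le_rfl (by simp)))
      · exact Or.inr hw
    · intro A' hss hA'
      rw [isComplement_iff] at hA'
      obtain ⟨α, ⟨c, hc, hαc⟩, hα'⟩ := Set.exists_of_ssubset hss
      obtain ⟨β, hβ, hw⟩ := hA' (α + a)
      obtain ⟨c', hc', hβc⟩ := hss.1 hβ
      rcases hw with hw | hw
      · obtain ⟨x, hx, hwx⟩ := exists_modEq_of_mem hY0mod hw
        have h := hβc.add hwx
        rw [add_sub_cancel] at h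
        have h' := (hαc.symm.add_right a).trans h
        by_cases hcc : c' = c
        · subst hcc
          exact ha x hx (Int.ModEq.add_left_cancel' _ h')
        · exact hsep c hc c' ⟨hc', hcc⟩ x hx h'
      · have : β = α := by
          have := Set.mem_singleton_iff.mp hw
          linarith
        exact hα' (this ▸ hβ)
end

section
/- Let m be a positive integer and let W = (mℕ + X_m) ∪ Y⁰ ∪ Y¹, where X_m ⊆ {0,1,...,m-1}, Y⁰ is a finite set of negative integers with Y⁰ mod m ⊆ X_m, and Y¹ is a finite set of integers with (Y¹ mod m) ∩ X_m = ∅. Then there exists a minimal additive complement to W in ℤ if and only if there exist a positive integer T with m ∣ T and a set C ⊆ {0,1,...,T-1} such that: (a) C + (X_T ∪ Y¹) mod T = {0,1,...,T-1}, where X_T = ⋃_{i=0}^{T/m − 1} (im + X_m); and (b) for every c ∈ C there exists y ∈ Y¹ such that c + y ≢ c' + x (mod T) for every c' ∈ C \ {c} and every x ∈ X_T ∪ Y¹. -/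
open Pointwise

/-- `XT m T X = ⋃_{i=0}^{T/m - 1} (i*m + X)`. -/
def XT (m T : ℤ) (X : Set ℤ) : Set ℤ :=
  {n : ℤ | ∃ i : ℤ, 0 ≤ i ∧ i < T / m ∧ ∃ x ∈ X, n = i * m + x}

/-- An integer whose residue mod `m` lies in `X` and which is nonnegative belongs to `mℕ + X`. -/
lemma mem_mNX_of_nonneg {m w : ℤ} {X : Set ℤ} (hm : 0 < m) (hw : 0 ≤ w) (hX : w % m ∈ X) :
    w ∈ mNX m X := by
  refine ⟨(w / m).toNat, w % m, hX, ?_⟩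
  rw [Int.toNat_of_nonneg (Int.ediv_nonneg hw hm.le)]
  linarith [Int.emod_add_mul_ediv w m, mul_comm m (w / m)]

lemma emod_mem_of_mem_mNX {m w : ℤ} {X : Set ℤ} (hX : X ⊆ Set.Ico 0 m) (hw : w ∈ mNX m X) :
    w % m ∈ X := by
  obtain ⟨k, x, hx, rfl⟩ := hw
  have h := hX hx
  rwa [add_comm, Int.add_mul_emod_self_right, Int.emod_eq_of_lt h.1 h.2]

lemma nonneg_of_mem_mNX {m w : ℤ} {X : Set ℤ} (hX : X ⊆ Set.Ico 0 m) (hw : w ∈ mNX m X) :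
    0 ≤ w := by
  obtain ⟨k, x, hx, rfl⟩ := hw
  have h := hX hx
  have : 0 < m := h.1.trans_lt h.2
  have := h.1
  positivity

lemma emod_mem_of_mem_XT {m T x : ℤ} {X : Set ℤ} (hX : X ⊆ Set.Ico 0 m) (hx : x ∈ XT m T X) :
    x % m ∈ X := by
  obtain ⟨i, -, -, x, hx, rfl⟩ := hx
  have h := hX hx
  rwa [add_comm, Int.add_mul_emod_self_right, Int.emod_eq_of_lt h.1 h.2]

lemma exists_mem_XT_modEq {m T r : ℤ} {X : Set ℤ} (hm : 0 < m) (hT : 0 < T) (hmT : m ∣ T)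
    (hr : r % m ∈ X) : ∃ x ∈ XT m T X, r ≡ x [ZMOD T] := by
  refine ⟨r % T, ⟨r % T / m, Int.ediv_nonneg (Int.emod_nonneg r hT.ne') hm.le, ?_, r % m, hr, ?_⟩,
    (Int.mod_modEq r T).symm⟩
  · obtain ⟨t, rfl⟩ := hmT
    rw [Int.mul_ediv_cancel_left t hm.ne']
    refine Int.ediv_lt_of_lt_mul hm ?_
    rw [mul_comm t]
    exact Int.emod_lt_of_pos r hT
  · rw [← Int.emod_emod_of_dvd r hmT]
    linarith [Int.emod_add_mul_ediv (r % T) m, mul_comm m (r % T / m)]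

/-- If `A₀ + Y` covers `U` and `Y` is finite, some minimal subset of `A₀` still covers `U`. -/
lemma exists_minimal_cover {Y U A₀ : Set ℤ} (hY : Y.Finite) (hU : U ⊆ A₀ + Y) :
    ∃ A, Minimal (fun A => A ⊆ A₀ ∧ U ⊆ A + Y) A := by
  refine zorn_superset {A | A ⊆ A₀ ∧ U ⊆ A + Y} fun 𝒞 h𝒞 hchain => ?_
  rcases 𝒞.eq_empty_or_nonempty with rfl | ⟨s₀, hs₀⟩
  · exact ⟨A₀, ⟨subset_rfl, hU⟩, by simp⟩
  refine ⟨⋂₀ 𝒞, ⟨(Set.sInter_subset_of_mem hs₀).trans (h𝒞 hs₀).1, fun u hu => ?_⟩,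
    fun s hs => Set.sInter_subset_of_mem hs⟩
  by_contra hcon
  have hmiss : ∀ y ∈ Y, ∃ s ∈ 𝒞, u - y ∉ s := by
    intro y hy
    by_contra! h
    exact hcon (Set.mem_add.2 ⟨u - y, h, y, hy, by ring⟩)
  have key : ∀ Z : Set ℤ, Z.Finite → (∀ y ∈ Z, ∃ s ∈ 𝒞, u - y ∉ s) →
      ∃ s ∈ 𝒞, ∀ y ∈ Z, u - y ∉ s := by
    intro Z hZ
    induction Z, hZ using Set.Finite.induction_on with
    | empty => exact fun _ => ⟨s₀, hs₀, by simp⟩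
    | @insert z Z _ _ ih =>
      intro h
      obtain ⟨s, hs, hsZ⟩ := ih fun y hy => h y (Set.mem_insert_of_mem _ hy)
      obtain ⟨t, ht, htz⟩ := h z (Set.mem_insert _ _)
      rcases hchain.total hs ht with hst | hts
      · refine ⟨s, hs, ?_⟩
        rintro y (rfl | hy)
        exacts [fun hys => htz (hst hys), hsZ y hy]
      · refine ⟨t, ht, ?_⟩
        rintro y (rfl | hy)
        exacts [htz, fun hyt => hsZ y hy (hts hyt)]
  obtain ⟨s, hs, hsY⟩ := key Y hY hmiss
  obtain ⟨a, ha, y, hy, rfl⟩ := Set.mem_add.1 ((h𝒞 hs).2 hu)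
  exact hsY y hy (by simpa using ha)

lemma exists_abs_le_of_finite {S : Set ℤ} (hS : S.Finite) : ∃ D, 0 ≤ D ∧ ∀ y ∈ S, |y| ≤ D := by
  obtain ⟨D, hD⟩ := (hS.image abs).bddAbove
  exact ⟨max D 0, le_max_right _ _, fun y hy =>
    (hD (Set.mem_image_of_mem _ hy)).trans (le_max_left _ _)⟩

/-- A periodic set satisfying the residue conditions contains a minimal complement. -/
lemma exists_isMinComplement_of_residues {m T : ℤ} {Xm Y0 Y1 C : Set ℤ} (hm : 0 < m)
    (hXm : Xm ⊆ Set.Ico 0 m) (hY0 : ∀ y ∈ Y0, y % m ∈ Xm) (hY1fin : Y1.Finite)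
    (hY1 : ∀ y ∈ Y1, y % m ∉ Xm) (hT : 0 < T) (hmT : m ∣ T) (hC : C ⊆ Set.Ico 0 T)
    (hcov : ∀ n : ℤ, ∃ c ∈ C, ∃ x ∈ XT m T Xm ∪ Y1, c + x ≡ n [ZMOD T])
    (huniq : ∀ c ∈ C, ∃ y ∈ Y1, ∀ c' ∈ C \ {c}, ∀ x ∈ XT m T Xm ∪ Y1,
      ¬ (c + y ≡ c' + x [ZMOD T])) :
    ∃ A : Set ℤ, IsMinComplement A (mNX m Xm ∪ Y0 ∪ Y1) := by
  set U : Set ℤ := {n | ∀ c ∈ C, (n - c) % m ∉ Xm} with hUdef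
  have hU : U ⊆ {a | a % T ∈ C} + Y1 := by
    intro n hn
    obtain ⟨c, hc, x, hx, hcx⟩ := hcov n
    rcases hx with hx | hx
    · refine absurd (emod_mem_of_mem_XT hXm hx) ?_
      have : n - c ≡ x [ZMOD m] := by
        simpa using ((hcx.symm.of_dvd hmT).sub_right c)
      rw [← this]
      exact hn c hc
    · refine Set.mem_add.2 ⟨n - x, ?_, x, hx, by ring⟩
      have : n - x ≡ c [ZMOD T] := by simpa using hcx.symm.sub_right x
      have hcT := hC hc
      rw [Set.mem_ofPred_eq, this.eq, Int.emod_eq_of_lt hcT.1 hcT.2]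
      exact hc
  obtain ⟨A, ⟨hAC, hAU⟩, hmin⟩ := exists_minimal_cover hY1fin hU
  obtain ⟨D, hD0, hD⟩ := exists_abs_le_of_finite hY1fin
  have hunbdd : ∀ c ∈ C, ∀ n : ℤ, ∃ a ∈ A, a ≤ n ∧ a ≡ c [ZMOD T] := by
    intro c hc n
    obtain ⟨y, hy, hyu⟩ := huniq c hc
    set k := |c + 2 * D - n|
    have hu : c + y - T * k ∈ U := by
      intro c' hc' hmem
      by_cases hcc : c' = c
      · subst hcc
        refine hY1 y hy ?_
        obtain ⟨t, rfl⟩ := hmT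
        rwa [show c' + y - m * t * k - c' = y + m * (-(t * k)) by ring,
          Int.add_mul_emod_self_left] at hmem
      · obtain ⟨x, hx, hxr⟩ := exists_mem_XT_modEq hm hT hmT hmem
        refine hyu c' ⟨hc', hcc⟩ x (Or.inl hx) ?_
        have h1 : c + y ≡ c + y - T * k [ZMOD T] :=
          Int.modEq_iff_dvd.2 ⟨-k, by ring⟩
        exact h1.trans (by simpa using hxr.add_left c')
    obtain ⟨a, ha, y', hy', hay⟩ := Set.mem_add.1 (hAU hu)
    refine ⟨a, ha, ?_, ?_⟩
    · have h1 := abs_le.1 (hD y hy)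
      have h2 := abs_le.1 (hD y' hy')
      have h3 : c + 2 * D - n ≤ k := le_abs_self _
      have h4 : 0 ≤ k := abs_nonneg _
      nlinarith
    · by_contra hne
      refine hyu (a % T) ⟨hAC ha, fun h => hne ?_⟩ y' (Or.inr hy') ?_
      · have h : a % T = c := h
        exact (Int.mod_modEq a T).symm.trans (by rw [h])
      · have h1 : c + y ≡ a + y' [ZMOD T] := Int.modEq_iff_dvd.2 ⟨-k, by rw [hay]; ring⟩
        exact h1.trans ((Int.mod_modEq a T).symm.add_right y')
  refine ⟨A, ?_, ?_⟩
  · refine Set.eq_univ_of_forall fun n => ?_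
    by_cases hn : n ∈ U
    · exact Set.add_subset_add_left Set.subset_union_right (hAU hn)
    · simp only [hUdef, Set.mem_ofPred_eq, not_forall, not_not] at hn
      obtain ⟨c, hc, hnc⟩ := hn
      obtain ⟨a, ha, han, hac⟩ := hunbdd c hc n
      refine Set.mem_add.2 ⟨a, ha, n - a, Or.inl (Or.inl ?_), by ring⟩
      refine mem_mNX_of_nonneg hm (by linarith) ?_
      rwa [((hac.of_dvd hmT).sub_left n : (n - a) % m = (n - c) % m)]
  · intro A' hA' hcompl
    refine hA'.2 (hmin ⟨hA'.1.trans hAC, fun u hu => ?_⟩ hA'.1)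
    obtain ⟨a, ha, w, hw, rfl⟩ := Set.mem_add.1 (hcompl.symm ▸ Set.mem_univ u)
    refine Set.mem_add.2 ⟨a, ha, w, ?_, rfl⟩
    have hwX : w % m ∉ Xm := by
      have h := hu _ (hAC (hA'.1 ha))
      have hmod : a + w - a % T ≡ w [ZMOD m] := by
        simpa using (((Int.mod_modEq a T).of_dvd hmT).sub_left (a + w))
      rwa [hmod.eq] at h
    rcases hw with (hw | hw) | hw
    exacts [absurd (emod_mem_of_mem_mNX hXm hw) hwX, absurd (hY0 w hw) hwX, hw]

/-- Elements of `A` far to the left lie in classes mod `m` that `A` meets arbitrarily far left. -/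
lemma exists_recurrent_bound (m : ℤ) (hm : 0 < m) (A : Set ℤ) :
    ∃ N, ∀ a ∈ A, a < N → ∀ B, ∃ a' ∈ A, a' ≤ B ∧ a' ≡ a [ZMOD m] := by
  have h : ∀ r : ℤ, ∃ N, (∃ B, ∀ a' ∈ A, a' ≤ B → ¬ a' ≡ r [ZMOD m]) →
      ∀ a ∈ A, a ≡ r [ZMOD m] → N ≤ a := by
    intro r
    by_cases hr : ∃ B, ∀ a' ∈ A, a' ≤ B → ¬ a' ≡ r [ZMOD m]
    · obtain ⟨B, hB⟩ := hr
      refine ⟨B, fun _ a ha har => ?_⟩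
      by_contra! hlt
      exact hB a ha hlt.le har
    · exact ⟨0, fun h => absurd h hr⟩
  choose f hf using h
  obtain ⟨N, hN⟩ := ((Set.finite_Ico 0 m).image f).bddBelow
  refine ⟨N, fun a ha haN => ?_⟩
  by_contra! hcon
  obtain ⟨B, hB⟩ := hcon
  have hmod := Int.mod_modEq a m
  have h1 := hf (a % m) ⟨B, fun a' ha' hle h => hB a' ha' hle (h.trans hmod)⟩ a ha hmod.symm
  have h2 := hN (Set.mem_image_of_mem f ⟨Int.emod_nonneg a hm.ne', Int.emod_lt_of_pos a hm⟩)
  linarith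

/-- A uniform lower bound for representatives of the classes of `A` mod `m`. -/
lemma exists_uniform_return (m : ℤ) (hm : 0 < m) (A : Set ℤ) (q : ℤ) :
    ∃ B, ∀ r, (∃ a ∈ A, a < q ∧ a ≡ r [ZMOD m]) → ∃ a ∈ A, B ≤ a ∧ a < q ∧ a ≡ r [ZMOD m] := by
  have h : ∀ r : ℤ, ∃ g, (∃ a ∈ A, a < q ∧ a ≡ r [ZMOD m]) → g ∈ A ∧ g < q ∧ g ≡ r [ZMOD m] := by
    intro r
    by_cases hr : ∃ a ∈ A, a < q ∧ a ≡ r [ZMOD m]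
    · obtain ⟨a, ha⟩ := hr
      exact ⟨a, fun _ => ha⟩
    · exact ⟨0, fun h => absurd h hr⟩
  choose g hg using h
  obtain ⟨B, hB⟩ := ((Set.finite_Ico 0 m).image g).bddBelow
  refine ⟨B, fun r ⟨a, ha, haq, har⟩ => ?_⟩
  have hmod := Int.mod_modEq r m
  obtain ⟨h1, h2, h3⟩ := hg (r % m) ⟨a, ha, haq, har.trans hmod.symm⟩
  exact ⟨_, h1, hB (Set.mem_image_of_mem g ⟨Int.emod_nonneg r hm.ne', Int.emod_lt_of_pos r hm⟩),
    h2, h3.trans hmod⟩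

/-- Some window of length `L` of `A` recurs arbitrarily far to the left, at distances divisible
by `m`. -/
lemma exists_repeated_window (m : ℤ) (hm : 0 < m) (A : Set ℤ) (L : ℕ) (s : ℤ) :
    ∃ q ≤ s, ∀ B, ∃ p ≤ B, m ∣ q - p ∧
      ∀ j : ℤ, 0 ≤ j → j < L → (p + j ∈ A ↔ q + j ∈ A) := by
  obtain ⟨P, hP⟩ := Finite.exists_infinite_fiber
    fun k : ℕ => {j : Fin L | s - m * k + (j : ℕ) ∈ A}
  rw [Set.infinite_coe_iff] at hP
  obtain ⟨k₀, hk₀⟩ := hP.nonempty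
  refine ⟨s - m * k₀, by nlinarith [Int.natCast_nonneg k₀], fun B => ?_⟩
  obtain ⟨k, hk, hkB⟩ := hP.exists_gt (s - B).toNat
  refine ⟨s - m * k, ?_, ⟨k - k₀, by ring⟩, fun j hj0 hjL => ?_⟩
  · have : s - B < k := by omega
    nlinarith
  · lift j to ℕ using hj0
    have h := Set.ext_iff.1 (hk.trans hk₀.symm) ⟨j, by exact_mod_cast hjL⟩
    exact h

/-- A minimal complement yields, by repeating a suitable stretch of it, a periodic set satisfying
the residue conditions. -/
lemma exists_residues_of_isMinComplement {m : ℤ} {Xm Y0 Y1 A : Set ℤ} (hm : 0 < m)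
    (hXm : Xm ⊆ Set.Ico 0 m) (hY0fin : Y0.Finite) (hY0 : ∀ y ∈ Y0, y % m ∈ Xm)
    (hY1fin : Y1.Finite) (hA : IsMinComplement A (mNX m Xm ∪ Y0 ∪ Y1)) :
    ∃ T : ℤ, 0 < T ∧ m ∣ T ∧ ∃ C ⊆ Set.Ico (0 : ℤ) T,
      (∀ n : ℤ, ∃ c ∈ C, ∃ x ∈ XT m T Xm ∪ Y1, c + x ≡ n [ZMOD T]) ∧
      ∀ c ∈ C, ∃ y ∈ Y1, ∀ c' ∈ C \ {c}, ∀ x ∈ XT m T Xm ∪ Y1, ¬ (c + y ≡ c' + x [ZMOD T]) := by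
  obtain ⟨hcompl, hmin⟩ := hA
  obtain ⟨D, hD0, hD⟩ := exists_abs_le_of_finite (hY0fin.union hY1fin)
  obtain ⟨N, hN⟩ := exists_recurrent_bound m hm A
  obtain ⟨q, hqs, hq⟩ := exists_repeated_window m hm A (4 * D).toNat (N - 4 * D)
  obtain ⟨B, hB⟩ := exists_uniform_return m hm A q
  obtain ⟨p, hp, hmT, hwin⟩ := hq (min B (q - 4 * D - 1))
  have hpB : p ≤ B := hp.trans (min_le_left _ _)
  have hpq : p ≤ q - 4 * D - 1 := hp.trans (min_le_right _ _)
  set T := q - p with hTdef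
  have hT : 0 < T := by omega
  set C : Set ℤ := {c | 0 ≤ c ∧ c < T ∧ ∃ a ∈ A, p ≤ a ∧ a < q ∧ a ≡ c [ZMOD T]} with hCdef
  -- On `[p, q + 4 * D)` the set `A` agrees with its periodic continuation.
  have hmemC : ∀ a ∈ A, p ≤ a → a < q + 4 * D → a % T ∈ C := by
    intro a ha hpa haq
    refine ⟨Int.emod_nonneg a hT.ne', Int.emod_lt_of_pos a hT, ?_⟩
    by_cases h : a < q
    · exact ⟨a, ha, hpa, h, (Int.mod_modEq a T).symm⟩
    · have h1 := (hwin (a - q) (by omega) (by omega)).2 (by simpa using ha)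
      refine ⟨_, h1, by omega, by omega, ?_⟩
      have h2 : p + (a - q) ≡ a [ZMOD T] := Int.modEq_iff_dvd.2 ⟨1, by rw [hTdef]; ring⟩
      exact h2.trans (Int.mod_modEq a T).symm
  have hmemA : ∀ c ∈ C, ∀ a, a ≡ c [ZMOD T] → p ≤ a → a < q + 4 * D → a ∈ A := by
    rintro c ⟨-, -, b, hb, hpb, hbq, hbc⟩ a hac hpa haq
    obtain ⟨k, hk⟩ := Int.modEq_iff_dvd.1 (hbc.trans hac.symm)
    have hk0 : 0 ≤ k := by
      by_contra! h
      nlinarith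
    have hk1 : k ≤ 1 := by
      by_contra! h
      nlinarith
    obtain rfl | rfl : k = 0 ∨ k = 1 := by omega
    · obtain rfl : a = b := by linarith
      exact hb
    · have h := (hwin (b - p) (by omega) (by omega)).1 (by simpa using hb)
      rwa [show q + (b - p) = a by omega] at h
  have hrep : ∀ n : ℤ, ∃ n', n' ≡ n [ZMOD T] ∧ p + 2 * D ≤ n' ∧ n' < q + 2 * D := by
    intro n
    refine ⟨p + 2 * D + (n - (p + 2 * D)) % T, ?_, ?_, ?_⟩
    · simpa using (Int.mod_modEq (n - (p + 2 * D)) T).add_left (p + 2 * D)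
    · linarith [Int.emod_nonneg (n - (p + 2 * D)) hT.ne']
    · linarith [Int.emod_lt_of_pos (n - (p + 2 * D)) hT]
  refine ⟨T, hT, hmT, C, fun c hc => ⟨hc.1, hc.2.1⟩, fun n => ?_, fun c hc => ?_⟩
  · obtain ⟨n', hn', hpn, hnq⟩ := hrep n
    obtain ⟨a, ha, w, hw, rfl⟩ := Set.mem_add.1 (hcompl.symm ▸ Set.mem_univ n')
    have hwD : -D ≤ w := by
      rcases hw with (hw | hw) | hw
      · linarith [nonneg_of_mem_mNX hXm hw]
      · exact (abs_le.1 (hD w (Or.inl hw))).1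
      · exact (abs_le.1 (hD w (Or.inr hw))).1
    have hX : w % m ∈ Xm ∨ w ∈ Y1 := by
      rcases hw with (hw | hw) | hw
      exacts [Or.inl (emod_mem_of_mem_mNX hXm hw), Or.inl (hY0 w hw), Or.inr hw]
    rcases hX with hX | hX
    · obtain ⟨a₁, ha₁, ha₁q, ha₁a⟩ := hN a ha (by omega) (q - 1)
      obtain ⟨b, hb, hBb, hbq, hba⟩ := hB a ⟨a₁, ha₁, by omega, ha₁a⟩
      have hbw : a + w - b ≡ w [ZMOD m] := by simpa using hba.sub_left (a + w)
      obtain ⟨x, hx, hxw⟩ := exists_mem_XT_modEq hm hT hmT (r := a + w - b) (X := Xm)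
        (by rwa [hbw.eq])
      refine ⟨b % T, hmemC b hb (by omega) (by omega), x, Or.inl hx, ?_⟩
      have h1 : b + x ≡ a + w [ZMOD T] := by simpa using hxw.symm.add_left b
      exact ((Int.mod_modEq b T).add_right x).trans (h1.trans hn')
    · have hwD' := abs_le.1 (hD w (Or.inr hX))
      exact ⟨a % T, hmemC a ha (by omega) (by omega), w, Or.inr hX,
        ((Int.mod_modEq a T).add_right w).trans hn'⟩
  · obtain ⟨a, hac, hpa, haq⟩ := hrep c
    have ha : a ∈ A := hmemA c hc a hac (by omega) (by omega)
    have hne := hmin (A \ {a}) ⟨Set.sdiff_subset, fun h => (h ha).2 rfl⟩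
    obtain ⟨n, hn⟩ := (Set.ne_univ_iff_exists_notMem _).1 hne
    have hfar : ∀ b ∈ A, b < N → (n - b) % m ∉ Xm := by
      intro b hb hbN hX
      obtain ⟨b', hb', hle, hbb⟩ := hN b hb hbN (min n (a - 1))
      have h1 := hle.trans (min_le_left _ _)
      have h2 := hle.trans (min_le_right _ _)
      refine hn (Set.mem_add.2 ⟨b', ⟨hb', fun h => ?_⟩, n - b', Or.inl (Or.inl ?_), by ring⟩)
      · have h : b' = a := h
        omega
      · refine mem_mNX_of_nonneg hm (by omega) ?_
        rwa [(hbb.sub_left n).eq]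
    obtain ⟨a', ha', y, hy, hay⟩ := Set.mem_add.1 (hcompl.symm ▸ Set.mem_univ n)
    obtain rfl : a' = a := by
      by_contra h
      exact hn (Set.mem_add.2 ⟨a', ⟨ha', h⟩, y, hy, hay⟩)
    subst hay
    have hyX : y % m ∉ Xm := by simpa using hfar a' ha (by omega)
    have hyY : y ∈ Y1 := by
      rcases hy with (hy | hy) | hy
      exacts [absurd (emod_mem_of_mem_mNX hXm hy) hyX, absurd (hY0 y hy) hyX, hy]
    refine ⟨y, hyY, ?_⟩
    rintro c' ⟨hc', hcc'⟩ x hx hcong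
    have hcong' : a' + y ≡ c' + x [ZMOD T] := (hac.add_right y).trans hcong
    rcases hx with hx | hx
    · obtain ⟨-, -, b, hb, hpb, hbq, hbc⟩ := hc'
      refine hfar b hb (by omega) ?_
      have h1 : a' + y - b ≡ x [ZMOD T] := by
        simpa using hcong'.sub hbc
      rw [(h1.of_dvd hmT).eq]
      exact emod_mem_of_mem_XT hXm hx
    · have hyD := abs_le.1 (hD y (Or.inr hyY))
      have hxD := abs_le.1 (hD x (Or.inr hx))
      have h1 : a' + y - x ≡ c' [ZMOD T] := by simpa using hcong'.sub_right x
      have hb := hmemA c' hc' _ h1 (by omega) (by omega)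
      refine hn (Set.mem_add.2 ⟨_, ⟨hb, fun h => hcc' ?_⟩, x, Or.inr hx, by ring⟩)
      have h : a' + y - x = a' := h
      rw [h] at h1
      have h2 : c' ≡ c [ZMOD T] := h1.symm.trans hac
      rw [Int.ModEq, Int.emod_eq_of_lt hc'.1 hc'.2.1, Int.emod_eq_of_lt hc.1 hc.2.1] at h2
      exact h2

theorem stmt_6 (m : ℤ) (hm : 0 < m) (Xm Y0 Y1 : Set ℤ)
    (hXm : Xm ⊆ Set.Ico 0 m)
    (hY0fin : Y0.Finite) (hY0neg : ∀ y ∈ Y0, y < 0)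
    (hY0mod : modSet Y0 m ⊆ Xm)
    (hY1fin : Y1.Finite) (hY1mod : modSet Y1 m ∩ Xm = ∅) :
    (∃ A : Set ℤ, IsMinComplement A (mNX m Xm ∪ Y0 ∪ Y1)) ↔
    ∃ T : ℤ, 0 < T ∧ m ∣ T ∧
      ∃ C ⊆ Set.Ico (0 : ℤ) T,
        modSet (C + (XT m T Xm ∪ Y1)) T = Set.Ico (0 : ℤ) T ∧
        ∀ c ∈ C, ∃ y ∈ Y1, ∀ c' ∈ C \ {c}, ∀ x ∈ XT m T Xm ∪ Y1,
          ¬ (c + y ≡ c' + x [ZMOD T]) := by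
  have hY0 : ∀ y ∈ Y0, y % m ∈ Xm := fun y hy => hY0mod (Set.mem_image_of_mem _ hy)
  have hY1 : ∀ y ∈ Y1, y % m ∉ Xm := fun y hy h =>
    (hY1mod ▸ ⟨Set.mem_image_of_mem _ hy, h⟩ : y % m ∈ (∅ : Set ℤ))
  constructor
  · rintro ⟨A, hA⟩
    obtain ⟨T, hT, hmT, C, hC, hcov, huniq⟩ :=
      exists_residues_of_isMinComplement hm hXm hY0fin hY0 hY1fin hA
    refine ⟨T, hT, hmT, C, hC, Set.Subset.antisymm ?_ fun n hn => ?_, huniq⟩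
    · rintro _ ⟨s, -, rfl⟩
      exact ⟨Int.emod_nonneg s hT.ne', Int.emod_lt_of_pos s hT⟩
    · obtain ⟨c, hc, x, hx, hcx⟩ := hcov n
      exact ⟨c + x, Set.add_mem_add hc hx, Eq.trans hcx (Int.emod_eq_of_lt hn.1 hn.2)⟩
  · rintro ⟨T, hT, hmT, C, hC, hcov, huniq⟩
    refine exists_isMinComplement_of_residues hm hXm hY0 hY1fin hY1 hT hmT hC (fun n => ?_) huniq
    have hn : n % T ∈ Set.Ico 0 T := ⟨Int.emod_nonneg n hT.ne', Int.emod_lt_of_pos n hT⟩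
    rw [← hcov] at hn
    obtain ⟨s, hs, hsn⟩ := hn
    obtain ⟨c, hc, x, hx, rfl⟩ := Set.mem_add.1 hs
    exact ⟨c, hc, x, hx, hsn⟩
end
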